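/- Let K ⊂ ℝⁿ be a symmetric convex body and E₁, E₂ ⊆ K ellipsoids contained in K with Vol(E₂) > 0. Then 1/M_{E₁}(E₂) ≤ (Vol(E₂)/Vol(E₁))^{1/n}, where M²_{E₁}(E₂) = ∫_{∂E₁} ‖x‖²_{E₂} dμ_{E₁}(x). Consequently, if E is the maximal-volume (Löwner-John) ellipsoid of K, then M_E(F) ≥ 1 for every ellipsoid F ⊆ K, with equality only for F = E. -/

import Mathlib

open MeasureTheory Metric Set

noncomputable section
attribute [local instance] Classical.propDecidable

variable {n : ℕ}

/-- A (nondegenerate, centrally symmetric) ellipsoid in `ℝⁿ`: the image of the closed unit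
ball under an invertible linear map. -/
def IsEllipsoid {n : ℕ} (F : Set (EuclideanSpace ℝ (Fin n))) : Prop :=
  ∃ L : EuclideanSpace ℝ (Fin n) ≃ₗ[ℝ] EuclideanSpace ℝ (Fin n),
    F = L '' closedBall 0 1

/-- The uniform (rotation-invariant) probability measure on the unit sphere of `ℝⁿ`,
viewed as a measure on `ℝⁿ`. -/
def sphereProb (n : ℕ) : Measure (EuclideanSpace ℝ (Fin n)) :=
  letI σ : Measure (EuclideanSpace ℝ (Fin n)) :=
    ((volume : Measure (EuclideanSpace ℝ (Fin n))).toSphere).map Subtype.val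
  (σ Set.univ)⁻¹ • σ

/-- The invariant probability measure `μ_E` on the boundary of the ellipsoid
`E = L(closedBall 0 1)`: the pushforward of the uniform sphere measure by `L`.
(It does not depend on the choice of `L`.) -/
def ellMeasure {n : ℕ} (E : Set (EuclideanSpace ℝ (Fin n))) :
    Measure (EuclideanSpace ℝ (Fin n)) :=
  if h : IsEllipsoid E then (sphereProb n).map h.choose else 0

/-- `M_E(F) = (∫_{∂E} ‖x‖_F² dμ_E(x))^{1/2}`, where `‖·‖_F` is the Minkowski gauge of `F`. -/
def Mfun {n : ℕ} (E F : Set (EuclideanSpace ℝ (Fin n))) : ℝ :=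
  Real.sqrt (∫ x, (gauge F x) ^ 2 ∂(ellMeasure E))

/-- `J_K(E) = inf { M_E(F) : F an ellipsoid contained in K }`. -/
def Jfun {n : ℕ} (K E : Set (EuclideanSpace ℝ (Fin n))) : ℝ :=
  sInf { r | ∃ F, IsEllipsoid F ∧ F ⊆ K ∧ r = Mfun E F }


open scoped Pointwise in
/-- Invariance of the (unnormalised) sphere measure under linear isometries. -/
lemma sphere_map_isometry (A : EuclideanSpace ℝ (Fin n) ≃ₗᵢ[ℝ] EuclideanSpace ℝ (Fin n)) :
    (((volume : Measure (EuclideanSpace ℝ (Fin n))).toSphere).map Subtype.val).map A =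
      ((volume : Measure (EuclideanSpace ℝ (Fin n))).toSphere).map Subtype.val := by
  have hA : Measurable A := A.continuous.measurable
  ext s hs
  rw [Measure.map_apply hA hs, Measure.map_apply measurable_subtype_coe (hA hs),
    Measure.map_apply measurable_subtype_coe hs,
    Measure.toSphere_apply' _ (measurable_subtype_coe (hA hs)),
    Measure.toSphere_apply' _ (measurable_subtype_coe hs)]
  congr 1
  have h := A.measurePreserving.measure_preimage_emb
    (A.toHomeomorph.measurableEmbedding)
    (Set.Ioo (0 : ℝ) 1 • (Subtype.val '' ((Subtype.val : sphere (0 : EuclideanSpace ℝ (Fin n)) 1 → _) ⁻¹' s)))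
  rw [← h]
  congr 1
  ext x
  simp only [Set.mem_smul, Set.mem_preimage, Set.mem_image]
  constructor
  · rintro ⟨r, hr, _, ⟨y, hy, rfl⟩, rfl⟩
    refine ⟨r, hr, A y, ⟨⟨A y, ?_⟩, hy, rfl⟩, by simp⟩
    simp
  · rintro ⟨r, hr, _, ⟨y, hy, rfl⟩, h⟩
    refine ⟨r, hr, A.symm y, ⟨⟨A.symm y, ?_⟩, ?_, rfl⟩, ?_⟩
    · simp
    · simpa using hy
    · apply A.injective
      simp [← h]

lemma sphereProb_map_isometry
    (A : EuclideanSpace ℝ (Fin n) ≃ₗᵢ[ℝ] EuclideanSpace ℝ (Fin n)) :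
    (sphereProb n).map A = sphereProb n := by
  unfold sphereProb
  simp only [Measure.map_smul, sphere_map_isometry]

lemma sphereProb_isProb (hn : 0 < n) : IsProbabilityMeasure (sphereProb n) := by
  haveI : Nonempty (Fin n) := ⟨⟨0, hn⟩⟩
  haveI : IsFiniteMeasure
    (((volume : Measure (EuclideanSpace ℝ (Fin n))).toSphere).map Subtype.val) :=
    Measure.isFiniteMeasure_map _ _
  constructor
  unfold sphereProb
  simp only [Measure.smul_apply, smul_eq_mul]
  apply ENNReal.inv_mul_cancel _ (measure_ne_top _ _)
  rw [Measure.map_apply measurable_subtype_coe MeasurableSet.univ, Set.preimage_univ]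
  rw [Ne, Measure.measure_univ_eq_zero]
  exact Measure.toSphere_ne_zero _

lemma sphereProb_ae (n : ℕ) : ∀ᵐ x ∂(sphereProb n), ‖x‖ = 1 := by
  unfold sphereProb
  apply Measure.ae_smul_measure
  rw [ae_map_iff measurable_subtype_coe.aemeasurable
    (measurableSet_eq_fun measurable_norm measurable_const)]
  exact Filter.Eventually.of_forall (fun x => by simp)

lemma integrable_inner_sq (hn : 0 < n) (v : EuclideanSpace ℝ (Fin n)) :
    Integrable (fun x => (inner ℝ v x) ^ 2) (sphereProb n) := by
  haveI := sphereProb_isProb hn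
  refine Integrable.of_bound ?_ (‖v‖ ^ 2) ?_
  · have hc : Continuous (fun x : EuclideanSpace ℝ (Fin n) => (inner ℝ v x : ℝ) ^ 2) := by
      fun_prop
    exact hc.aestronglyMeasurable
  · filter_upwards [sphereProb_ae n] with x hx
    have := abs_real_inner_le_norm v x
    rw [hx, mul_one] at this
    rw [norm_pow, Real.norm_eq_abs]
    gcongr

lemma integral_inner_sq (hn : 0 < n)
    (b : OrthonormalBasis (Fin n) ℝ (EuclideanSpace ℝ (Fin n))) (i : Fin n) :
    ∫ x, (inner ℝ (b i) x) ^ 2 ∂(sphereProb n) = 1 / n := by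
  haveI := sphereProb_isProb hn
  have hsymm : ∀ j, ∫ x, (inner ℝ (b j) x) ^ 2 ∂(sphereProb n)
      = ∫ x, (inner ℝ (b i) x) ^ 2 ∂(sphereProb n) := by
    intro j
    let A := b.equiv b (Equiv.swap i j)
    have hA : A (b i) = b j := by simp [A]
    conv_lhs => rw [← sphereProb_map_isometry A]
    rw [integral_map A.continuous.measurable.aemeasurable
      (Continuous.aestronglyMeasurable (by fun_prop))]
    congr 1
    ext x
    rw [← hA, A.inner_map_map]
  have hsum : ∑ j, ∫ x, (inner ℝ (b j) x) ^ 2 ∂(sphereProb n) = 1 := by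
    rw [← integral_finsetSum _ (fun j _ => integrable_inner_sq hn (b j))]
    have : ∫ x, ∑ j, (inner ℝ (b j) x) ^ 2 ∂(sphereProb n) = ∫ x, (1 : ℝ) ∂(sphereProb n) := by
      apply integral_congr_ae
      filter_upwards [sphereProb_ae n] with x hx
      have := b.sum_sq_norm_inner_right x
      simp only [Real.norm_eq_abs, sq_abs] at this
      rw [this, hx, one_pow]
    rw [this]
    simp
  simp only [hsymm, Finset.sum_const, Finset.card_univ, Fintype.card_fin, nsmul_eq_mul] at hsum
  have : (n : ℝ) ≠ 0 := by positivity
  field_simp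
  linarith

/-- Diagonalisation of `TᵀT`. -/
lemma exists_diag (T : EuclideanSpace ℝ (Fin n) →ₗ[ℝ] EuclideanSpace ℝ (Fin n)) :
    ∃ (b : OrthonormalBasis (Fin n) ℝ (EuclideanSpace ℝ (Fin n))) (z : Fin n → ℝ),
      (∀ i, 0 ≤ z i) ∧ (∀ x, ‖T x‖ ^ 2 = ∑ i, z i * (inner ℝ (b i) x) ^ 2) ∧
      (LinearMap.det T) ^ 2 = ∏ i, z i := by
  have hp := T.isPositive_adjoint_comp_self
  have hf : Module.finrank ℝ (EuclideanSpace ℝ (Fin n)) = n := by simp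
  refine ⟨hp.1.eigenvectorBasis hf, hp.1.eigenvalues hf, hp.nonneg_eigenvalues hf, ?_, ?_⟩
  · intro x
    rw [← real_inner_self_eq_norm_sq, ← LinearMap.adjoint_inner_right,
      ← LinearMap.comp_apply,
      ← (hp.1.eigenvectorBasis hf).sum_inner_mul_inner]
    refine Finset.sum_congr rfl fun i _ => ?_
    rw [← hp.1, hp.1.apply_eigenvectorBasis hf i, inner_smul_left, real_inner_comm]
    simp
    ring
  · have := hp.1.det_eq_prod_eigenvalues hf
    rw [LinearMap.det_comp] at this
    simp at this
    rw [← this, sq]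
    congr 1
    have b := (EuclideanSpace.basisFun (Fin n) ℝ)
    rw [← LinearMap.det_toMatrix b.toBasis, ← LinearMap.det_toMatrix b.toBasis,
      LinearMap.toMatrix_adjoint b b, Matrix.det_conjTranspose]
    simp

lemma core (hn : 0 < n) (T : EuclideanSpace ℝ (Fin n) →ₗ[ℝ] EuclideanSpace ℝ (Fin n)) :
    ((LinearMap.det T) ^ 2) ^ ((1 : ℝ) / n) ≤ ∫ x, ‖T x‖ ^ 2 ∂(sphereProb n) ∧
    (∫ x, ‖T x‖ ^ 2 ∂(sphereProb n) = 1 → 1 ≤ (LinearMap.det T) ^ 2 → ∀ x, ‖T x‖ = ‖x‖) := by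
  obtain ⟨b, z, hz, hT, hd⟩ := exists_diag T
  have hn' : (0 : ℝ) < n := by exact_mod_cast hn
  have hI : ∫ x, ‖T x‖ ^ 2 ∂(sphereProb n) = ∑ i, (1 / n : ℝ) * z i := by
    simp only [hT]
    rw [integral_finsetSum _ (fun j _ => (integrable_inner_sq hn (b j)).const_mul _)]
    refine Finset.sum_congr rfl fun i _ => ?_
    rw [integral_const_mul, integral_inner_sq hn, mul_comm]
  have hw : ∑ i : Fin n, (1 / n : ℝ) = 1 := by
    simp [hn'.ne']
  have hle := Real.geom_mean_le_arith_mean_weighted Finset.univ (fun _ : Fin n => (1 / n : ℝ)) z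
    (fun _ _ => by positivity) hw (fun i _ => hz i)
  have hprod : ∏ i, z i ^ (1 / n : ℝ) = ((LinearMap.det T) ^ 2) ^ ((1 : ℝ) / n) := by
    rw [hd, Real.finsetProd_rpow _ _ (fun i _ => hz i)]
  rw [hI, ← hprod]
  refine ⟨hle, fun h1 hdet x => ?_⟩
  have h2 : 1 ≤ ∏ i, z i ^ (1 / n : ℝ) := by
    rw [hprod]
    exact Real.one_le_rpow hdet (by positivity)
  have heq := (Real.geom_mean_eq_arith_mean_weighted_iff_of_pos' Finset.univ
    (fun _ : Fin n => (1 / n : ℝ)) z (fun _ _ => by positivity) hw (fun i _ => hz i)).1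
    (le_antisymm hle (h1.trans_le h2))
  have hz1 : ∀ i, z i = 1 := fun i => (heq i (Finset.mem_univ i)).trans h1
  have h3 := hT x
  have := b.sum_sq_norm_inner_right x
  simp only [Real.norm_eq_abs, sq_abs] at this
  simp only [hz1, one_mul, this] at h3
  exact (sq_eq_sq₀ (norm_nonneg _) (norm_nonneg _)).1 h3

lemma gauge_ellipsoid (L : EuclideanSpace ℝ (Fin n) ≃ₗ[ℝ] EuclideanSpace ℝ (Fin n))
    (x : EuclideanSpace ℝ (Fin n)) : gauge (L '' closedBall 0 1) x = ‖L.symm x‖ := by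
  have h := gauge_closedBall zero_le_one (L.symm x)
  rw [div_one] at h
  rw [← h]
  unfold gauge
  congr 1
  ext r
  simp only [Set.mem_setOf_eq]
  refine and_congr_right fun _ => ?_
  constructor
  · rintro ⟨_, ⟨y, hy, rfl⟩, h⟩
    exact ⟨y, hy, by simp [← h]⟩
  · rintro ⟨y, hy, h⟩
    refine ⟨L y, ⟨y, hy, rfl⟩, ?_⟩
    apply L.symm.injective
    simpa using h

/-- Reduction of `M` to an operator. -/
lemma exists_operator {E F : Set (EuclideanSpace ℝ (Fin n))} (hE : IsEllipsoid E)
    (hF : IsEllipsoid F) :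
    ∃ T : EuclideanSpace ℝ (Fin n) ≃ₗ[ℝ] EuclideanSpace ℝ (Fin n),
      Mfun E F = Real.sqrt (∫ x, ‖T x‖ ^ 2 ∂(sphereProb n)) ∧
      (volume F).toReal / (volume E).toReal
        = |LinearMap.det (T : EuclideanSpace ℝ (Fin n) →ₗ[ℝ] EuclideanSpace ℝ (Fin n))|⁻¹ ∧
      ((∀ x, ‖T x‖ = ‖x‖) → F = E) := by
  obtain ⟨L₂, hL₂⟩ := hF
  have hL₁ := hE.choose_spec
  set L₁ := hE.choose with hdef
  refine ⟨L₁.trans L₂.symm, ?_, ?_, ?_⟩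
  · unfold Mfun ellMeasure
    rw [dif_pos hE, ← hdef]
    have hm : Measurable L₁ := L₁.toContinuousLinearEquiv.continuous.measurable
    have hc : Continuous L₂.symm := L₂.symm.toContinuousLinearEquiv.continuous
    simp only [hL₂, gauge_ellipsoid]
    rw [integral_map hm.aemeasurable (Continuous.aestronglyMeasurable (by fun_prop))]
    rfl
  · have h1 := Measure.addHaar_image_linearMap volume
      (L₁ : EuclideanSpace ℝ (Fin n) →ₗ[ℝ] EuclideanSpace ℝ (Fin n)) (closedBall 0 1)
    have h2 := Measure.addHaar_image_linearMap volume
      (L₂ : EuclideanSpace ℝ (Fin n) →ₗ[ℝ] EuclideanSpace ℝ (Fin n)) (closedBall 0 1)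
    simp only [LinearEquiv.coe_coe] at h1 h2
    have hb : 0 < (volume (closedBall (0 : EuclideanSpace ℝ (Fin n)) 1)).toReal :=
      ENNReal.toReal_pos (measure_closedBall_pos _ _ one_pos).ne' measure_closedBall_lt_top.ne
    have hd1 : LinearMap.det
      (L₁ : EuclideanSpace ℝ (Fin n) →ₗ[ℝ] EuclideanSpace ℝ (Fin n)) ≠ 0 :=
      L₁.isUnit_det'.ne_zero
    have hd2 : LinearMap.det
      (L₂ : EuclideanSpace ℝ (Fin n) →ₗ[ℝ] EuclideanSpace ℝ (Fin n)) ≠ 0 :=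
      L₂.isUnit_det'.ne_zero
    have hs := L₂.det_symm_mul_det
    have hd : LinearMap.det ((L₁.trans L₂.symm : EuclideanSpace ℝ (Fin n) ≃ₗ[ℝ] _) :
        EuclideanSpace ℝ (Fin n) →ₗ[ℝ] EuclideanSpace ℝ (Fin n))
        = LinearMap.det (L₂.symm : EuclideanSpace ℝ (Fin n) →ₗ[ℝ] EuclideanSpace ℝ (Fin n))
        * LinearMap.det (L₁ : EuclideanSpace ℝ (Fin n) →ₗ[ℝ] EuclideanSpace ℝ (Fin n)) := by
      rw [← LinearMap.det_comp]
      rfl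
    rw [hL₁, hL₂, h1, h2, hd, eq_inv_of_mul_eq_one_left hs]
    rw [ENNReal.toReal_mul, ENNReal.toReal_mul, ENNReal.toReal_ofReal (abs_nonneg _),
      ENNReal.toReal_ofReal (abs_nonneg _), abs_mul, abs_inv]
    have := abs_pos.2 hd1
    have := abs_pos.2 hd2
    field_simp
  · intro h
    rw [hL₁, hL₂]
    ext x
    constructor
    · rintro ⟨y, hy, rfl⟩
      refine ⟨L₁.symm (L₂ y), ?_, by simp⟩
      have := h (L₁.symm (L₂ y))
      simp at this
      simpa [← this] using hy
    · rintro ⟨y, hy, rfl⟩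
      refine ⟨L₂.symm (L₁ y), ?_, by simp⟩
      have := h y
      simp at this
      simpa [this] using hy

/-- Volume bound for `M`: for ellipsoids `E₁, E₂ ⊆ K`,
`1/M_{E₁}(E₂) ≤ (Vol(E₂)/Vol(E₁))^{1/n}`; consequently, if `E` is the maximal-volume
(Löwner–John) ellipsoid of `K`, then `M_E(F) ≥ 1` for every ellipsoid `F ⊆ K`, with
equality only for `F = E`. -/
theorem M_volume_bound_and_LJ_minimality
    (n : ℕ) (hn : 0 < n) (K : Set (EuclideanSpace ℝ (Fin n)))
    (hKconv : Convex ℝ K) (hKcomp : IsCompact K) (hKsymm : K = -K)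
    (hKint : (0 : EuclideanSpace ℝ (Fin n)) ∈ interior K) :
    (∀ E₁ E₂ : Set (EuclideanSpace ℝ (Fin n)), IsEllipsoid E₁ → IsEllipsoid E₂ →
      E₁ ⊆ K → E₂ ⊆ K → 0 < volume E₂ →
      1 / Mfun E₁ E₂ ≤ ((volume E₂).toReal / (volume E₁).toReal) ^ ((1 : ℝ) / n)) ∧
    (∀ E : Set (EuclideanSpace ℝ (Fin n)), IsEllipsoid E → E ⊆ K →
      (∀ F, IsEllipsoid F → F ⊆ K → volume F ≤ volume E) →
      ∀ F, IsEllipsoid F → F ⊆ K → 1 ≤ Mfun E F ∧ (Mfun E F = 1 → F = E)) := by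
  have key : ∀ E F : Set (EuclideanSpace ℝ (Fin n)), IsEllipsoid E → IsEllipsoid F →
      0 < Mfun E F ∧
      1 / Mfun E F ≤ ((volume F).toReal / (volume E).toReal) ^ ((1 : ℝ) / n) ∧
      (1 ≤ (volume E).toReal / (volume F).toReal → Mfun E F = 1 → F = E) := by
    intro E F hE hF
    obtain ⟨T, hM, hV, hEq⟩ := exists_operator hE hF
    obtain ⟨h1, h2⟩ := core hn (T : EuclideanSpace ℝ (Fin n) →ₗ[ℝ] EuclideanSpace ℝ (Fin n))
    simp only [LinearEquiv.coe_coe] at h1 h2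
    have hd0 : 0 < |LinearMap.det
      (T : EuclideanSpace ℝ (Fin n) →ₗ[ℝ] EuclideanSpace ℝ (Fin n))| :=
      abs_pos.2 T.isUnit_det'.ne_zero
    set d := LinearMap.det (T : EuclideanSpace ℝ (Fin n) →ₗ[ℝ] EuclideanSpace ℝ (Fin n))
    have h3 : |d| ^ ((1 : ℝ) / n) ≤ Mfun E F := by
      rw [hM]
      apply Real.le_sqrt_of_sq_le
      refine le_trans (le_of_eq ?_) h1
      rw [← sq_abs d, Real.rpow_pow_comm hd0.le]
    have hp : 0 < |d| ^ ((1 : ℝ) / n) := Real.rpow_pos_of_pos hd0 _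
    refine ⟨hp.trans_le h3, ?_, ?_⟩
    · rw [hV, Real.inv_rpow hd0.le, one_div]
      exact inv_anti₀ hp h3
    · intro h4 h5
      apply hEq
      apply h2
      · rw [hM, Real.sqrt_eq_one] at h5
        exact h5
      · rw [← inv_div, hV, inv_inv] at h4
        rw [← sq_abs]
        exact one_le_pow₀ h4
  refine ⟨fun E₁ E₂ h1 h2 _ _ _ => (key E₁ E₂ h1 h2).2.1, ?_⟩
  intro E hE hEK hmax F hF hFK
  obtain ⟨h0, h1, h2⟩ := key E F hE hF
  have hpos : ∀ G : Set (EuclideanSpace ℝ (Fin n)), IsEllipsoid G →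
      0 < (volume G).toReal ∧ volume G ≠ ⊤ := by
    rintro G ⟨L, rfl⟩
    have h := Measure.addHaar_image_linearMap volume
      (L : EuclideanSpace ℝ (Fin n) →ₗ[ℝ] EuclideanSpace ℝ (Fin n)) (closedBall 0 1)
    simp only [LinearEquiv.coe_coe] at h
    rw [h]
    have hb : 0 < (volume (closedBall (0 : EuclideanSpace ℝ (Fin n)) 1)).toReal :=
      ENNReal.toReal_pos (measure_closedBall_pos _ _ one_pos).ne' measure_closedBall_lt_top.ne
    refine ⟨?_, ENNReal.mul_ne_top ENNReal.ofReal_ne_top measure_closedBall_lt_top.ne⟩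
    rw [ENNReal.toReal_mul, ENNReal.toReal_ofReal (abs_nonneg _)]
    exact mul_pos (abs_pos.2 L.isUnit_det'.ne_zero) hb
  have hle : (volume F).toReal ≤ (volume E).toReal :=
    ENNReal.toReal_mono (hpos E hE).2 (hmax F hF hFK)
  constructor
  · have h3 : ((volume F).toReal / (volume E).toReal) ^ ((1 : ℝ) / n) ≤ 1 :=
      Real.rpow_le_one (by positivity) (div_le_one_of_le₀ hle (by positivity)) (by positivity)
    have := h1.trans h3
    rwa [div_le_one h0] at this
  · exact h2 ((one_le_div (hpos F hF).1).2 hle)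

end
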